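/- arXiv:0707.0975 — 2 statements merged into one kernel-verified Lean document; each statement's English description precedes it below -/
import Mathlib

section
/- Let k be a field and C a k-coalgebra. On C^e = C ⊗ C define the coproduct Δ^e(c ⊗ c̄) = (c_(1) ⊗ c̄_(2)) ⊗ (c_(2) ⊗ c̄_(1)), counit ε^e = ε ⊗ ε, multiplication μ^e(c ⊗ c̄ ⊗ d ⊗ d̄) = ε(c) ε(d̄) d ⊗ c̄, and unit η^e(c) = c_(2) ⊗ c_(1). Then: (i) Δ^e ∘ μ^e = (μ^e ⊗ μ^e) ∘ tw_{23} ∘ (Δ^e ⊗ Δ^e) as k-linear maps (C⊗C)⊗(C⊗C) → (C⊗C)⊗(C⊗C), where tw_{23} swaps the second and third (C⊗C)-legs; (ii) μ^e is associative: μ^e ∘ (μ^e ⊗ id_{C⊗C}) = μ^e ∘ (id_{C⊗C} ⊗ μ^e) on (C⊗C)^{⊗3}; (iii) η^e is a unit: for all c ⊗ c̄ ∈ C ⊗ C, μ^e((c̄_(1)(2) ⊗ c̄_(1)(1)) ⊗ (c ⊗ c̄_(2))) = c ⊗ c̄ and μ^e((c_(1) ⊗ c̄) ⊗ (c_(2)(2)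 ⊗ c_(2)(1))) = c ⊗ c̄; (iv) ε^e(μ^e(x ⊗ y)) = ε^e(x) ε^e(y) for all x, y ∈ C ⊗ C. -/
/- STATEMENT 2: the co-enveloping coalgebra C^e = C ⊗ C_cop with
Δ^e(c⊗c̄) = (c_(1)⊗c̄_(2))⊗(c_(2)⊗c̄_(1)), ε^e = ε⊗ε,
μ^e(c⊗c̄⊗d⊗d̄) = ε(c)ε(d̄) d⊗c̄, η^e(c) = c_(2)⊗c_(1)
satisfies: (i) comultiplicativity of μ^e, (ii) associativity of μ^e,
(iii) the unit laws for η^e, (iv) counitality of μ^e. -/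

noncomputable section
open TensorProduct Coalgebra LinearMap

variable (k : Type*) [Field k]
variable (C : Type*) [AddCommGroup C] [Module k C] [Coalgebra k C]

/-- `μ^e(c ⊗ c̄ ⊗ d ⊗ d̄) = ε(c) ε(d̄) d ⊗ c̄`. -/
def muE : (C ⊗[k] C) ⊗[k] (C ⊗[k] C) →ₗ[k] C ⊗[k] C :=
  (TensorProduct.map
      ((TensorProduct.lid k C).toLinearMap ∘ₗ LinearMap.rTensor C (counit (R := k)))
      ((TensorProduct.rid k C).toLinearMap ∘ₗ LinearMap.lTensor C (counit (R := k)))) ∘ₗ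
    (tensorTensorTensorComm k C C C C).toLinearMap

/-- `Δ^e(c ⊗ c̄) = (c_(1) ⊗ c̄_(2)) ⊗ (c_(2) ⊗ c̄_(1))`. -/
def deltaE : C ⊗[k] C →ₗ[k] (C ⊗[k] C) ⊗[k] (C ⊗[k] C) :=
  (tensorTensorTensorComm k C C C C).toLinearMap ∘ₗ
    TensorProduct.map (comul (R := k))
      ((TensorProduct.comm k C C).toLinearMap ∘ₗ comul (R := k))

/-- `ε^e = ε ⊗ ε`. -/
def epsE : C ⊗[k] C →ₗ[k] k :=
  (TensorProduct.lid k k).toLinearMap ∘ₗ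
    TensorProduct.map (counit (R := k)) (counit (R := k))

/-- `η^e(c) = c_(2) ⊗ c_(1)`. -/
def etaE : C →ₗ[k] C ⊗[k] C :=
  (TensorProduct.comm k C C).toLinearMap ∘ₗ comul (R := k)

/-- `λ_R(c ⊗ c̄) = c̄_(1) ⊗ (c ⊗ c̄_(2))`. -/
def lamRE : C ⊗[k] C →ₗ[k] C ⊗[k] (C ⊗[k] C) :=
  (TensorProduct.leftComm k C C C).toLinearMap ∘ₗ LinearMap.lTensor C (comul (R := k))

/-- `ρ_R(c ⊗ c̄) = (c_(1) ⊗ c̄) ⊗ c_(2)`. -/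
def rhoRE : C ⊗[k] C →ₗ[k] (C ⊗[k] C) ⊗[k] C :=
  (TensorProduct.assoc k C C C).symm.toLinearMap ∘ₗ
    LinearMap.lTensor C (TensorProduct.comm k C C).toLinearMap ∘ₗ
    (TensorProduct.assoc k C C C).toLinearMap ∘ₗ
    LinearMap.rTensor C (comul (R := k))

variable {k C}

@[simp]
lemma muE_tmul (a b c d : C) :
    muE k C ((a ⊗ₜ b) ⊗ₜ (c ⊗ₜ d)) = (counit (R := k) a * counit (R := k) d) • (c ⊗ₜ[k] b) := by
  simp [muE, ← TensorProduct.smul_tmul', TensorProduct.tmul_smul, smul_smul, mul_comm]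

@[simp]
lemma epsE_tmul (a b : C) :
    epsE k C (a ⊗ₜ b) = counit (R := k) a * counit (R := k) b := by
  simp [epsE]

lemma epsE_comul (c : C) : epsE k C (comul (R := k) c) = counit (R := k) c := by
  have h (x : C ⊗[k] C) :
      epsE k C x = counit (R := k) (TensorProduct.lid k C (rTensor C (counit (R := k)) x)) := by
    induction x with
    | zero => simp
    | tmul a b => simp
    | add x y hx hy => simp only [map_add, hx, hy]
  simp [h]

lemma deltaE_tmul (a b : C) :
    deltaE k C (a ⊗ₜ b) = tensorTensorTensorComm k C C C C
      (comul (R := k) a ⊗ₜ TensorProduct.comm k C C (comul (R := k) b)) := by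
  simp [deltaE]

lemma map_muE_muE (x y z w : C ⊗[k] C) :
    TensorProduct.map (muE k C) (muE k C)
      (tensorTensorTensorComm k (C ⊗[k] C) (C ⊗[k] C) (C ⊗[k] C) (C ⊗[k] C)
        (tensorTensorTensorComm k C C C C (x ⊗ₜ y) ⊗ₜ
          tensorTensorTensorComm k C C C C (z ⊗ₜ w))) =
      (epsE k C x * epsE k C w) • tensorTensorTensorComm k C C C C (z ⊗ₜ y) := by
  induction x with
  | zero => simp
  | add x x' hx hx' => simp only [add_tmul, map_add, hx, hx', add_mul, add_smul]
  | tmul a a' =>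
  induction w with
  | zero => simp
  | add x x' hx hx' => simp only [tmul_add, map_add, hx, hx', mul_add, add_smul]
  | tmul d d' =>
  induction y with
  | zero => simp
  | add x x' hx hx' => simp only [tmul_add, add_tmul, map_add, hx, hx', smul_add]
  | tmul b b' =>
  induction z with
  | zero => simp
  | add x x' hx hx' => simp only [tmul_add, add_tmul, map_add, hx, hx', smul_add]
  | tmul c c' =>
  simp only [tensorTensorTensorComm_tmul, TensorProduct.map_tmul, muE_tmul, epsE_tmul,
    ← TensorProduct.smul_tmul', TensorProduct.tmul_smul, smul_smul]
  congr 1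
  ring

lemma epsE_comm (x : C ⊗[k] C) : epsE k C (TensorProduct.comm k C C x) = epsE k C x := by
  induction x with
  | zero => simp
  | tmul a b => simp [mul_comm]
  | add x y hx hy => simp only [map_add, hx, hy]

lemma muE_tmul_right (x : C ⊗[k] C) (c d : C) :
    muE k C (TensorProduct.comm k C C x ⊗ₜ (c ⊗ₜ d)) =
      counit (R := k) d •
        (c ⊗ₜ[k] TensorProduct.rid k C (lTensor C (counit (R := k)) x)) := by
  induction x with
  | zero => simp
  | tmul a b => simp [TensorProduct.tmul_smul, smul_smul, mul_comm]
  | add x y hx hy => simp only [map_add, add_tmul, tmul_add, smul_add, hx, hy]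

lemma muE_tmul_left (x : C ⊗[k] C) (a b : C) :
    muE k C ((a ⊗ₜ b) ⊗ₜ TensorProduct.comm k C C x) =
      counit (R := k) a •
        (TensorProduct.lid k C (rTensor C (counit (R := k)) x) ⊗ₜ[k] b) := by
  induction x with
  | zero => simp
  | tmul c d => simp [TensorProduct.smul_tmul', smul_smul]
  | add x y hx hy => simp only [map_add, add_tmul, tmul_add, smul_add, hx, hy]

@[simp]
lemma muE_etaE_tmul (a c d : C) :
    muE k C (etaE k C a ⊗ₜ (c ⊗ₜ d)) = counit (R := k) d • (c ⊗ₜ[k] a) := by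
  simp [etaE, muE_tmul_right]

@[simp]
lemma muE_tmul_etaE (a b c : C) :
    muE k C ((a ⊗ₜ b) ⊗ₜ etaE k C c) = counit (R := k) a • (c ⊗ₜ[k] b) := by
  simp [etaE, muE_tmul_left]

lemma muE_etaE_lamRE (c d : C) :
    muE k C (rTensor (C ⊗[k] C) (etaE k C) (lamRE k C (c ⊗ₜ d))) = c ⊗ₜ d := by
  have h (x : C ⊗[k] C) :
      muE k C (rTensor (C ⊗[k] C) (etaE k C) (TensorProduct.leftComm k C C C (c ⊗ₜ x))) =
        c ⊗ₜ[k] TensorProduct.rid k C (lTensor C (counit (R := k)) x) := by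
    induction x with
    | zero => simp
    | tmul a b => simp [TensorProduct.tmul_smul]
    | add x y hx hy => simp only [map_add, tmul_add, hx, hy]
  simp [lamRE, h]

lemma muE_etaE_rhoRE (c d : C) :
    muE k C (lTensor (C ⊗[k] C) (etaE k C) (rhoRE k C (c ⊗ₜ d))) = c ⊗ₜ d := by
  have h (x : C ⊗[k] C) :
      muE k C (lTensor (C ⊗[k] C) (etaE k C) ((TensorProduct.assoc k C C C).symm
        (lTensor C (TensorProduct.comm k C C).toLinearMap
          (TensorProduct.assoc k C C C (x ⊗ₜ d))))) =
        TensorProduct.lid k C (rTensor C (counit (R := k)) x) ⊗ₜ[k] d := by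
    induction x with
    | zero => simp
    | tmul a b => simp [TensorProduct.smul_tmul']
    | add x y hx hy => simp only [map_add, add_tmul, hx, hy]
  simp [rhoRE, h]

variable (k C)

theorem coenveloping_right_bicoalgebroid_algebra_part :
    -- (i) Δ^e ∘ μ^e = (μ^e ⊗ μ^e) ∘ tw₂₃ ∘ (Δ^e ⊗ Δ^e)
    (deltaE k C ∘ₗ muE k C =
      TensorProduct.map (muE k C) (muE k C) ∘ₗ
        (tensorTensorTensorComm k (C ⊗[k] C) (C ⊗[k] C) (C ⊗[k] C) (C ⊗[k] C)).toLinearMap ∘ₗ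
        TensorProduct.map (deltaE k C) (deltaE k C)) ∧
    -- (ii) μ^e associative
    (muE k C ∘ₗ LinearMap.rTensor (C ⊗[k] C) (muE k C) =
      muE k C ∘ₗ LinearMap.lTensor (C ⊗[k] C) (muE k C) ∘ₗ
        (TensorProduct.assoc k (C ⊗[k] C) (C ⊗[k] C) (C ⊗[k] C)).toLinearMap) ∧
    -- (iii) η^e is a unit:  μ^e ∘ (η^e ⊗ id) ∘ λ_R = id = μ^e ∘ (id ⊗ η^e) ∘ ρ_R
    (muE k C ∘ₗ LinearMap.rTensor (C ⊗[k] C) (etaE k C) ∘ₗ lamRE k C =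
      LinearMap.id) ∧
    (muE k C ∘ₗ LinearMap.lTensor (C ⊗[k] C) (etaE k C) ∘ₗ rhoRE k C =
      LinearMap.id) ∧
    -- (iv) ε^e(μ^e(x ⊗ y)) = ε^e(x) ε^e(y)
    (epsE k C ∘ₗ muE k C =
      (TensorProduct.lid k k).toLinearMap ∘ₗ TensorProduct.map (epsE k C) (epsE k C)) := by
  refine ⟨?_, ?_, ?_, ?_, ?_⟩
  · ext a b c d
    simp [deltaE_tmul, map_muE_muE, epsE_comul, epsE_comm]
  · ext a b c d e f
    simp [← TensorProduct.smul_tmul', TensorProduct.tmul_smul, smul_smul]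
    congr 1
    ring
  · ext c d
    simp [muE_etaE_lamRE]
  · ext c d
    simp [muE_etaE_rhoRE]
  · ext a b c d
    simp
    ring
end
end

section
/- Let k be a field and let (H, Δ, ε, μ, η, α, β, C) satisfy the left bicoalgebroid axioms. Let X be a right C-comodule with coaction x ↦ x_[0] ⊗ x_[1], and let ◁: X ▢_C H → X be a right H-action (associative and unital: x_[0] ◁ η(x_[1]) = x) which is a right C-comodule map: (x ◁ h)_[0] ⊗ (x ◁ h)_[1] = x ◁ h_(2) ⊗ β(h_(1)). Then X carries a unique left C-coaction τ: X → C ⊗ X, necessarily given by τ(x) = β(η(x_[1])_(2)) ⊗ x_[0] ◁ η(x_[1])_(1), such that: (1) τ is coassociative and, together with the given right coaction, makes X a C-bicomodule; (2) ◁ is also a left C-comodule map, i.e. (x ◁ h)_[-1] ⊗ (x ◁ h)_[0] = β(h_(2)) ⊗ x ◁ h_(1) (where τ(x) = x_[-1] ⊗ x_[0]); (3) ◁ factorizes through the cocenter X ⊠ H, i.e. (x_[0] ◁ η(x_[1])_(1)) ◁ h ⊗ β(η(x_[1])_(2)) = x_[0] ◁ h ⊗ x_[-1]. -/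
noncomputable section
open TensorProduct Coalgebra LinearMap

variable (k : Type*) [Field k]
variable (H C : Type*)
  [AddCommGroup H] [Module k H] [Coalgebra k H]
  [AddCommGroup C] [Module k C] [Coalgebra k C]

/-- `λ_L(h) = α(h_(1)) ⊗ h_(2)`. -/
def lamL (α : H →ₗ[k] C) : H →ₗ[k] C ⊗[k] H :=
  TensorProduct.map α LinearMap.id ∘ₗ comul

/-- `ρ_L(h) = h_(2) ⊗ β(h_(1))`. -/
def rhoL (β : H →ₗ[k] C) : H →ₗ[k] H ⊗[k] C :=
  (TensorProduct.comm k C H).toLinearMap ∘ₗ TensorProduct.map β LinearMap.id ∘ₗ comul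

variable {k H C}

/-- the two maps whose equality defines the cotensor product `H ▢_C H`. -/
def cotL (β : H →ₗ[k] C) : H ⊗[k] H →ₗ[k] (H ⊗[k] C) ⊗[k] H :=
  LinearMap.rTensor H (rhoL k H C β)

def cotR (α : H →ₗ[k] C) : H ⊗[k] H →ₗ[k] (H ⊗[k] C) ⊗[k] H :=
  (TensorProduct.assoc k H C H).symm.toLinearMap ∘ₗ LinearMap.lTensor H (lamL k H C α)

/-- membership in `H ▢_C H`: `Σ g_(2) ⊗ β(g_(1)) ⊗ h = Σ g ⊗ α(h_(1)) ⊗ h_(2)`. -/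
def inCot (α β : H →ₗ[k] C) (t : H ⊗[k] H) : Prop :=
  cotL β t = cotR α t

variable (k H C)

/-- A left bicoalgebroid `⟨H, Δ, ε, μ, η, α, β, C⟩` (Brzeziński–Militaru),
with total multiplication `μ : H ⊗ H → H` whose axioms are imposed on the
cotensor product `H ▢_C H`. -/
structure LeftBicoalgebroid where
  α : H →ₗ[k] C
  β : H →ₗ[k] C
  mu : H ⊗[k] H →ₗ[k] H
  eta : C →ₗ[k] H
  /-- α is a coalgebra map -/
  alpha_comul : ∀ h : H, comul (α h) = TensorProduct.map α α (comul h)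
  alpha_counit : ∀ h : H, counit (α h) = (counit h : k)
  /-- β is an anti-coalgebra map -/
  beta_comul : ∀ h : H, comul (β h) =
    (TensorProduct.comm k C C) (TensorProduct.map β β (comul h))
  beta_counit : ∀ h : H, counit (β h) = (counit h : k)
  /-- α and β cocommute -/
  cocommute : ∀ h : H, TensorProduct.map α β (comul h) =
    TensorProduct.map α β ((TensorProduct.comm k H H) (comul h))
  /-- the Takeuchi-type condition: `Σ μ(g ⊗ h_(1)) ⊗ α(h_(2)) = Σ μ(g_(1) ⊗ h) ⊗ β(g_(2))` -/
  mu_takeuchi : ∀ t : H ⊗[k] H, inCot α β t →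
    (TensorProduct.map mu α) ((TensorProduct.assoc k H H H).symm
      ((LinearMap.lTensor H (comul (R := k))) t)) =
    (TensorProduct.map mu β) ((TensorProduct.assoc k H H H).symm
      ((LinearMap.lTensor H (TensorProduct.comm k H H).toLinearMap)
        ((TensorProduct.assoc k H H H)
          ((LinearMap.rTensor H (comul (R := k))) t))))
  /-- comultiplicativity: `Δ(μ(g ⊗ h)) = μ(g_(1) ⊗ h_(1)) ⊗ μ(g_(2) ⊗ h_(2))` -/
  mu_comul : ∀ t : H ⊗[k] H, inCot α β t →
    comul (mu t) = (TensorProduct.map mu mu)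
      ((tensorTensorTensorComm k H H H H)
        ((TensorProduct.map (comul (R := k)) (comul (R := k))) t))
  /-- counitality: `ε(μ(g ⊗ h)) = ε(g) ε(h)` -/
  mu_counit : ∀ t : H ⊗[k] H, inCot α β t →
    (counit (mu t) : k) = (TensorProduct.lid k k)
      ((TensorProduct.map (counit (R := k)) (counit (R := k))) t)
  /-- μ is a left C-comodule map -/
  mu_leftComod : ∀ t : H ⊗[k] H, inCot α β t →
    lamL k H C α (mu t) = (TensorProduct.map α mu)
      ((TensorProduct.assoc k H H H) ((LinearMap.rTensor H (comul (R := k))) t))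
  /-- μ is a right C-comodule map -/
  mu_rightComod : ∀ t : H ⊗[k] H, inCot α β t →
    rhoL k H C β (mu t) = (TensorProduct.map mu β)
      ((TensorProduct.assoc k H H H).symm
        ((LinearMap.lTensor H
          ((TensorProduct.comm k H H).toLinearMap ∘ₗ comul (R := k))) t))
  /-- associativity of μ on `H ▢_C H ▢_C H` -/
  mu_assoc : ∀ u : (H ⊗[k] H) ⊗[k] H,
    (LinearMap.rTensor H (cotL β)) u = (LinearMap.rTensor H (cotR α)) u →
    (LinearMap.lTensor H (cotL β)) ((TensorProduct.assoc k H H H) u) =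
      (LinearMap.lTensor H (cotR α)) ((TensorProduct.assoc k H H H) u) →
    mu ((LinearMap.rTensor H mu) u) =
      mu ((LinearMap.lTensor H mu) ((TensorProduct.assoc k H H H) u))
  /-- η is a left C-comodule map -/
  eta_leftComod : ∀ c : C, lamL k H C α (eta c) =
    (LinearMap.lTensor C eta) (comul c)
  /-- η is a right C-comodule map -/
  eta_rightComod : ∀ c : C, rhoL k H C β (eta c) =
    (LinearMap.rTensor C eta) (comul c)
  /-- unit law: `μ ∘ (η ▢ H) ∘ λ_L = id` -/
  unit_left : ∀ h : H, mu ((LinearMap.rTensor H eta) (lamL k H C α h)) = h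
  /-- unit law: `μ ∘ (H ▢ η) ∘ ρ_L = id` -/
  unit_right : ∀ h : H, mu ((LinearMap.lTensor H eta) (rhoL k H C β h)) = h
  /-- `Δ(η(c)) = η(c)_(1) ⊗ η(α(η(c)_(2)))` -/
  eta_comul_alpha : ∀ c : C, comul (eta c) =
    (LinearMap.lTensor H (eta ∘ₗ α)) (comul (eta c))
  /-- `Δ(η(c)) = η(c)_(1) ⊗ η(β(η(c)_(2)))` -/
  eta_comul_beta : ∀ c : C, comul (eta c) =
    (LinearMap.lTensor H (eta ∘ₗ β)) (comul (eta c))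
  /-- `ε(η(c)) = ε(c)` -/
  eta_counit : ∀ c : C, (counit (eta c) : k) = counit c

/- STATEMENT 8: a right module X over a left bicoalgebroid H carries a unique
left C-coaction τ, necessarily τ(x) = β(η(x_[1])_(2)) ⊗ x_[0] ◁ η(x_[1])_(1),
making X a C-bicomodule for which the action is a bicomodule map factorizing
through the cocenter X ⊠ H. -/

variable {X : Type*} [AddCommGroup X] [Module k X]

/-- membership in the cotensor product `X ▢_C H`. -/
def inCotXH (α : H →ₗ[k] C) (rhoX : X →ₗ[k] X ⊗[k] C) (w : X ⊗[k] H) : Prop :=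
  (LinearMap.rTensor H rhoX) w =
    (TensorProduct.assoc k X C H).symm ((LinearMap.lTensor X (lamL k H C α)) w)

/-- interchange `(X ⊗ C) ⊗ H → (X ⊗ H) ⊗ C`. -/
def swapCH : (X ⊗[k] C) ⊗[k] H →ₗ[k] (X ⊗[k] H) ⊗[k] C :=
  (TensorProduct.assoc k X H C).symm.toLinearMap ∘ₗ
    LinearMap.lTensor X (TensorProduct.comm k C H).toLinearMap ∘ₗ
    (TensorProduct.assoc k X C H).toLinearMap

/-- the property required of the left coaction τ in Statement 8:
(1) it makes X a C-bicomodule, (2) the action is a left C-comodule map,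
(3) the action factorizes through the cocenter X ⊠ H. -/
def GoodLeftCoaction (B : LeftBicoalgebroid k H C)
    (rhoX : X →ₗ[k] X ⊗[k] C) (act : X ⊗[k] H →ₗ[k] X)
    (τ : X →ₗ[k] C ⊗[k] X) : Prop :=
  -- (1) τ is a coassociative counital left coaction commuting with ρ_X
  (∀ x : X, (TensorProduct.assoc k C C X)
      ((LinearMap.rTensor X (comul (R := k))) (τ x)) = (LinearMap.lTensor C τ) (τ x)) ∧
  (∀ x : X, (TensorProduct.lid k X)
      ((LinearMap.rTensor X (counit (R := k) (A := C))) (τ x)) = x) ∧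
  (∀ x : X, (TensorProduct.assoc k C X C)
      ((LinearMap.rTensor C τ) (rhoX x)) = (LinearMap.lTensor C rhoX) (τ x)) ∧
  -- (2) the action is a left C-comodule map: (x ◁ h)_[-1] ⊗ (x ◁ h)_[0] = β(h_(2)) ⊗ x ◁ h_(1)
  (∀ w : X ⊗[k] H, inCotXH k H C B.α rhoX w →
    τ (act w) = (TensorProduct.comm k X C)
      ((TensorProduct.map act LinearMap.id)
        ((TensorProduct.assoc k X H C).symm
          ((LinearMap.lTensor X (LinearMap.lTensor H B.β ∘ₗ comul)) w)))) ∧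
  -- (3) factorization through the cocenter:
  -- (x_[0] ◁ η(x_[1])_(1)) ◁ h ⊗ β(η(x_[1])_(2)) = x_[0] ◁ h ⊗ x_[-1]
  (∀ w : X ⊗[k] H, inCotXH k H C B.α rhoX w →
    (TensorProduct.map act LinearMap.id)
      (swapCH k H C
        ((LinearMap.rTensor H (LinearMap.rTensor C act))
          ((LinearMap.rTensor H
            ((TensorProduct.assoc k X H C).symm.toLinearMap ∘ₗ
              LinearMap.lTensor X (LinearMap.lTensor H B.β ∘ₗ comul (R := k) ∘ₗ B.eta) ∘ₗ
              rhoX)) w))) =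
    (TensorProduct.map act LinearMap.id)
      (swapCH k H C
        ((LinearMap.rTensor H ((TensorProduct.comm k C X).toLinearMap ∘ₗ τ)) w)))

section Slices

variable {k}
variable {V W U Z : Type*} [AddCommGroup V] [Module k V] [AddCommGroup W] [Module k W]
  [AddCommGroup U] [Module k U] [AddCommGroup Z] [Module k Z]

/-- Contract the left tensor factor with a functional. -/
def sliceL (f : V →ₗ[k] k) : V ⊗[k] W →ₗ[k] W :=
  (TensorProduct.lid k W).toLinearMap ∘ₗ LinearMap.rTensor W f

/-- Contract the right tensor factor with a functional. -/
def sliceR (f : W →ₗ[k] k) : V ⊗[k] W →ₗ[k] V :=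
  (TensorProduct.rid k V).toLinearMap ∘ₗ LinearMap.lTensor V f

@[simp] lemma sliceL_tmul (f : V →ₗ[k] k) (v : V) (w : W) :
    sliceL f (v ⊗ₜ[k] w) = f v • w := by simp [sliceL]

@[simp] lemma sliceR_tmul (f : W →ₗ[k] k) (v : V) (w : W) :
    sliceR f (v ⊗ₜ[k] w) = f w • v := by simp [sliceR]

lemma ext_sliceL {s t : V ⊗[k] W} (h : ∀ f : V →ₗ[k] k, sliceL f s = sliceL f t) : s = t := by
  classical
  let b := Module.Basis.ofVectorSpace k V
  apply (TensorProduct.equivFinsuppOfBasisLeft (N := W) b).injective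
  ext i
  simpa [TensorProduct.equivFinsuppOfBasisLeft_apply, sliceL] using h (b.coord i)

lemma sliceL_comm (f : V →ₗ[k] k) (t : W ⊗[k] V) :
    sliceL f (TensorProduct.comm k W V t) = sliceR f t := by
  induction t <;> simp_all

lemma sliceR_comm (f : W →ₗ[k] k) (t : W ⊗[k] V) :
    sliceR f (TensorProduct.comm k W V t) = sliceL f t := by
  induction t <;> simp_all

lemma ext_sliceR {s t : V ⊗[k] W} (h : ∀ f : W →ₗ[k] k, sliceR f s = sliceR f t) : s = t := by
  apply (TensorProduct.comm k V W).injective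
  exact ext_sliceL fun f => by simpa [sliceL_comm] using h f

lemma sliceL_lTensor (f : V →ₗ[k] k) (g : W →ₗ[k] U) (t : V ⊗[k] W) :
    sliceL f (LinearMap.lTensor V g t) = g (sliceL f t) := by
  induction t <;> simp_all

lemma sliceR_rTensor (f : W →ₗ[k] k) (g : V →ₗ[k] U) (t : V ⊗[k] W) :
    sliceR f (LinearMap.rTensor W g t) = g (sliceR f t) := by
  induction t <;> simp_all

lemma sliceL_rTensor (f : U →ₗ[k] k) (g : V →ₗ[k] U) (t : V ⊗[k] W) :
    sliceL f (LinearMap.rTensor W g t) = sliceL (f ∘ₗ g) t := by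
  induction t <;> simp_all

lemma sliceR_lTensor (f : U →ₗ[k] k) (g : W →ₗ[k] U) (t : V ⊗[k] W) :
    sliceR f (LinearMap.lTensor V g t) = sliceR (f ∘ₗ g) t := by
  induction t <;> simp_all

lemma sliceR_map (f : U →ₗ[k] k) (g : V →ₗ[k] Z) (g' : W →ₗ[k] U) (t : V ⊗[k] W) :
    sliceR f (TensorProduct.map g g' t) = g (sliceR (f ∘ₗ g') t) := by
  induction t <;> simp_all

lemma sliceL_map (f : U →ₗ[k] k) (g : W →ₗ[k] Z) (g' : V →ₗ[k] U) (t : V ⊗[k] W) :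
    sliceL f (TensorProduct.map g' g t) = g (sliceL (f ∘ₗ g') t) := by
  induction t <;> simp_all

lemma sliceL_assoc (f : V →ₗ[k] k) (t : (V ⊗[k] W) ⊗[k] U) :
    sliceL f (TensorProduct.assoc k V W U t) = LinearMap.rTensor U (sliceL f) t := by
  revert t
  refine DFunLike.congr_fun (f := sliceL f ∘ₗ (TensorProduct.assoc k V W U).toLinearMap) ?_
  ext; simp [TensorProduct.smul_tmul']

lemma sliceR_assoc_symm (f : U →ₗ[k] k) (t : V ⊗[k] (W ⊗[k] U)) :
    sliceR f ((TensorProduct.assoc k V W U).symm t) = LinearMap.lTensor V (sliceR f) t := by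
  revert t
  refine DFunLike.congr_fun (f := sliceR f ∘ₗ (TensorProduct.assoc k V W U).symm.toLinearMap) ?_
  ext; simp

lemma lTensor_sliceL_assoc (f : W →ₗ[k] k) (t : (V ⊗[k] W) ⊗[k] U) :
    LinearMap.lTensor V (sliceL f) (TensorProduct.assoc k V W U t) =
      LinearMap.rTensor U (sliceR f) t := by
  revert t
  refine DFunLike.congr_fun
    (f := LinearMap.lTensor V (sliceL f) ∘ₗ (TensorProduct.assoc k V W U).toLinearMap) ?_
  ext; simp [TensorProduct.smul_tmul']

lemma rTensor_sliceR_assoc_symm (f : W →ₗ[k] k) (t : V ⊗[k] (W ⊗[k] U)) :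
    LinearMap.rTensor U (sliceR f) ((TensorProduct.assoc k V W U).symm t) =
      LinearMap.lTensor V (sliceL f) t := by
  rw [← lTensor_sliceL_assoc, LinearEquiv.apply_symm_apply]

/-- Elements of a triple tensor product are separated by contracting the middle factor. -/
lemma ext_rTensor_sliceR {s t : (V ⊗[k] W) ⊗[k] U}
    (h : ∀ f : W →ₗ[k] k,
      LinearMap.rTensor U (sliceR f) s = LinearMap.rTensor U (sliceR f) t) : s = t := by
  have key (f : W →ₗ[k] k) (z : (V ⊗[k] W) ⊗[k] U) :
      sliceL f (TensorProduct.assoc k W V U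
        (LinearMap.rTensor U (TensorProduct.comm k V W).toLinearMap z)) =
        LinearMap.rTensor U (sliceR f) z := by
    rw [sliceL_assoc, ← LinearMap.comp_apply, ← LinearMap.rTensor_comp]
    congr 2
    ext; simp
  have := ext_sliceL fun f => (key f s).trans ((h f).trans (key f t).symm)
  exact (TensorProduct.congr (TensorProduct.comm k V W) (LinearEquiv.refl k U)).injective
    ((TensorProduct.assoc k W V U).injective this)

/-- An implication between linear conditions on `W` that ends in an equality of functionals
may be applied to an element of `V ⊗ W` slicewise. -/
lemma sliceR_eq_of_sliceL {R S : W →ₗ[k] k} {z : V ⊗[k] W}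
    (h : ∀ f : V →ₗ[k] k, R (sliceL f z) = S (sliceL f z)) : sliceR R z = sliceR S z := by
  have key (f : V →ₗ[k] k) (R : W →ₗ[k] k) (z : V ⊗[k] W) :
      f (sliceR R z) = R (sliceL f z) := by
    induction z <;> simp_all [mul_comm]
  refine sub_eq_zero.1 ((Module.forall_dual_apply_eq_zero_iff k _).1 fun f => ?_)
  rw [map_sub, key, key, h, sub_self]

lemma lTensor_assoc_symm (g : U →ₗ[k] Z) (t : V ⊗[k] (W ⊗[k] U)) :
    LinearMap.lTensor (V ⊗[k] W) g ((TensorProduct.assoc k V W U).symm t) =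
      (TensorProduct.assoc k V W Z).symm (LinearMap.lTensor V (LinearMap.lTensor W g) t) := by
  rw [LinearEquiv.eq_symm_apply, LinearMap.lTensor_tensor]
  simp

lemma lTensor_lTensor (f : W →ₗ[k] U) (g : U →ₗ[k] Z) (t : V ⊗[k] W) :
    LinearMap.lTensor V g (LinearMap.lTensor V f t) = LinearMap.lTensor V (g ∘ₗ f) t :=
  (LinearMap.lTensor_comp_apply V g f t).symm

lemma rTensor_rTensor (f : W →ₗ[k] U) (g : U →ₗ[k] Z) (t : W ⊗[k] V) :
    LinearMap.rTensor V g (LinearMap.rTensor V f t) = LinearMap.rTensor V (g ∘ₗ f) t :=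
  (LinearMap.rTensor_comp_apply V g f t).symm

lemma rTensor_comm_lTensor {V' W' : Type*} [AddCommGroup V'] [Module k V'] [AddCommGroup W']
    [Module k W'] (f : V →ₗ[k] V') (g : W →ₗ[k] W') (t : V ⊗[k] W) :
    LinearMap.rTensor W' f (LinearMap.lTensor V g t) =
      LinearMap.lTensor V' g (LinearMap.rTensor W f t) := by
  induction t <;> simp_all

lemma tensorTensorTensorComm_map (f₁ f₂ f₃ f₄ : V →ₗ[k] V)
    (a : (V ⊗[k] V) ⊗[k] (V ⊗[k] V)) :
    tensorTensorTensorComm k V V V V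
        (TensorProduct.map (TensorProduct.map f₁ f₂) (TensorProduct.map f₃ f₄) a) =
      TensorProduct.map (TensorProduct.map f₁ f₃) (TensorProduct.map f₂ f₄)
        (tensorTensorTensorComm k V V V V a) :=
  DFunLike.congr_fun (tensorTensorTensorComm_comp_map k f₁ f₂ f₃ f₄) a

end Slices

section Hit

variable {k} {D : Type*} [AddCommGroup D] [Module k D] [Coalgebra k D]

/-- `h ↦ f(h_(1)) h_(2)`. -/
def hitL (f : D →ₗ[k] k) : D →ₗ[k] D := sliceL f ∘ₗ comul

/-- `h ↦ f(h_(2)) h_(1)`. -/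
def hitR (f : D →ₗ[k] k) : D →ₗ[k] D := sliceR f ∘ₗ comul

lemma comul_hitL (f : D →ₗ[k] k) (h : D) :
    comul (R := k) (hitL f h) = LinearMap.rTensor D (hitL f) (comul h) := by
  rw [hitL, LinearMap.rTensor_comp, LinearMap.comp_apply, LinearMap.comp_apply, ← sliceL_lTensor,
    ← Coalgebra.coassoc_apply, sliceL_assoc]

lemma comul_hitR (f : D →ₗ[k] k) (h : D) :
    comul (R := k) (hitR f h) = LinearMap.lTensor D (hitR f) (comul h) := by
  rw [hitR, LinearMap.lTensor_comp, LinearMap.comp_apply, LinearMap.comp_apply, ← sliceR_rTensor,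
    ← Coalgebra.coassoc_symm_apply, sliceR_assoc_symm]

lemma rTensor_hitR_comul (f : D →ₗ[k] k) (h : D) :
    LinearMap.rTensor D (hitR f) (comul h) = LinearMap.lTensor D (hitL f) (comul h) := by
  rw [hitR, hitL, LinearMap.lTensor_comp, LinearMap.rTensor_comp, LinearMap.comp_apply,
    LinearMap.comp_apply, ← Coalgebra.coassoc_apply, lTensor_sliceL_assoc]

lemma hitL_hitL (f g : D →ₗ[k] k) (h : D) :
    hitL f (hitL g h) = sliceL (f ∘ₗ hitL g) (comul h) := by
  rw [← sliceL_rTensor, ← comul_hitL]; rfl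

lemma hitR_hitR (f g : D →ₗ[k] k) (h : D) :
    hitR f (hitR g h) = sliceR (f ∘ₗ hitR g) (comul h) := by
  rw [← sliceR_lTensor, ← comul_hitR]; rfl

lemma hitR_hitL (f g : D →ₗ[k] k) (h : D) : hitR f (hitL g h) = hitL g (hitR f h) := by
  conv_lhs => rw [hitR, LinearMap.comp_apply, comul_hitL, sliceR_rTensor]
  rfl

lemma apply_hitL (f g : D →ₗ[k] k) (h : D) :
    f (hitL g h) = LinearMap.mul' k k (TensorProduct.map g f (comul h)) := by
  rw [hitL, LinearMap.comp_apply]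
  induction comul (R := k) h <;> simp_all

lemma apply_hitR (f g : D →ₗ[k] k) (h : D) :
    f (hitR g h) = LinearMap.mul' k k (TensorProduct.map f g (comul h)) := by
  rw [hitR, LinearMap.comp_apply]
  induction comul (R := k) h <;> simp_all [mul_comm]

lemma counit_hitL (f : D →ₗ[k] k) (h : D) : counit (R := k) (hitL f h) = f h := by
  have : f (sliceR (counit (R := k)) (comul (R := k) h)) = f h := by simp [sliceR]
  rw [← this, hitL, LinearMap.comp_apply]
  induction comul (R := k) h <;> simp_all [mul_comm]

end Hit

section Bicoalgebroid

variable {k H}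

section

variable {E : Type*} [AddCommGroup E] [Module k E]

lemma sliceR_rhoL (β : H →ₗ[k] E) (f : E →ₗ[k] k) :
    sliceR f ∘ₗ rhoL k H E β = hitL (f ∘ₗ β) := by
  ext h
  simp [rhoL, sliceR_comm, sliceL_map, hitL]

lemma sliceL_lamL (α : H →ₗ[k] E) (f : E →ₗ[k] k) :
    sliceL f ∘ₗ lamL k H E α = hitL (f ∘ₗ α) := by
  ext h
  simp [lamL, sliceL_map, hitL]

lemma inCot_iff (α β : H →ₗ[k] E) (t : H ⊗[k] H) :
    inCot α β t ↔ ∀ f : E →ₗ[k] k,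
      LinearMap.rTensor H (hitL (f ∘ₗ β)) t = LinearMap.lTensor H (hitL (f ∘ₗ α)) t := by
  have hl (f : E →ₗ[k] k) : LinearMap.rTensor H (sliceR f) (cotL β t) =
      LinearMap.rTensor H (hitL (f ∘ₗ β)) t := by
    rw [cotL, ← LinearMap.comp_apply, ← LinearMap.rTensor_comp, sliceR_rhoL]
  have hr (f : E →ₗ[k] k) : LinearMap.rTensor H (sliceR f) (cotR α t) =
      LinearMap.lTensor H (hitL (f ∘ₗ α)) t := by
    rw [cotR, LinearMap.comp_apply, LinearEquiv.coe_coe, rTensor_sliceR_assoc_symm,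
      ← LinearMap.comp_apply, ← LinearMap.lTensor_comp, sliceL_lamL]
  refine ⟨fun h f => ?_, fun h => ext_rTensor_sliceR fun f => ?_⟩
  · rw [← hl, ← hr, h]
  · rw [hl, hr, h]

lemma inCotXH_iff (α : H →ₗ[k] E) (rhoX : X →ₗ[k] X ⊗[k] E) (w : X ⊗[k] H) :
    inCotXH k H E α rhoX w ↔ ∀ f : E →ₗ[k] k,
      LinearMap.rTensor H (sliceR f ∘ₗ rhoX) w = LinearMap.lTensor X (hitL (f ∘ₗ α)) w := by
  have hr (f : E →ₗ[k] k) : LinearMap.rTensor H (sliceR f)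
      ((TensorProduct.assoc k X E H).symm (LinearMap.lTensor X (lamL k H E α) w)) =
      LinearMap.lTensor X (hitL (f ∘ₗ α)) w := by
    rw [rTensor_sliceR_assoc_symm, ← LinearMap.comp_apply, ← LinearMap.lTensor_comp, sliceL_lamL]
  refine ⟨fun h f => ?_, fun h => ext_rTensor_sliceR fun f => ?_⟩
  · rw [← hr, ← h, LinearMap.rTensor_comp, LinearMap.comp_apply]
  · rw [hr, ← h, LinearMap.rTensor_comp, LinearMap.comp_apply]

end

variable {C}

/-- `g ⊗ h ↦ (g_(1) ⊗ h_(1)) ⊗ (g_(2) ⊗ h_(2))`. -/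
def comulTensor : H ⊗[k] H →ₗ[k] (H ⊗[k] H) ⊗[k] (H ⊗[k] H) :=
  (tensorTensorTensorComm k H H H H).toLinearMap ∘ₗ
    TensorProduct.map (comul (R := k)) (comul (R := k))

lemma comulTensor_map {f f₁ f₂ g g₁ g₂ : H →ₗ[k] H}
    (hf : ∀ h, comul (R := k) (f h) = TensorProduct.map f₁ f₂ (comul h))
    (hg : ∀ h, comul (R := k) (g h) = TensorProduct.map g₁ g₂ (comul h)) (t : H ⊗[k] H) :
    comulTensor (TensorProduct.map f g t) =
      TensorProduct.map (TensorProduct.map f₁ g₁) (TensorProduct.map f₂ g₂) (comulTensor t) := by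
  induction t with
  | zero => simp
  | add a b ha hb => simp only [map_add, ha, hb]
  | tmul g h =>
    simp only [comulTensor, LinearMap.comp_apply, TensorProduct.map_tmul, LinearEquiv.coe_coe,
      hf, hg, ← tensorTensorTensorComm_map]

lemma comulTensor_rTensor_hitL (f : H →ₗ[k] k) (t : H ⊗[k] H) :
    comulTensor (LinearMap.rTensor H (hitL f) t) =
      LinearMap.rTensor (H ⊗[k] H) (LinearMap.rTensor H (hitL f)) (comulTensor t) := by
  have := comulTensor_map (f := hitL f) (g := LinearMap.id) (comul_hitL f)
    (g₁ := LinearMap.id) (g₂ := LinearMap.id) (by simp) t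
  simpa [LinearMap.rTensor, LinearMap.lTensor] using this

lemma comulTensor_lTensor_hitL (f : H →ₗ[k] k) (t : H ⊗[k] H) :
    comulTensor (LinearMap.lTensor H (hitL f) t) =
      LinearMap.rTensor (H ⊗[k] H) (LinearMap.lTensor H (hitL f)) (comulTensor t) := by
  have := comulTensor_map (g := hitL f) (f := LinearMap.id) (f₁ := LinearMap.id)
    (f₂ := LinearMap.id) (by simp) (comul_hitL f) t
  simpa [LinearMap.rTensor, LinearMap.lTensor] using this

lemma rTensor_rTensor_hitR_comulTensor (f : H →ₗ[k] k) (t : H ⊗[k] H) :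
    LinearMap.rTensor (H ⊗[k] H) (LinearMap.rTensor H (hitR f)) (comulTensor t) =
      LinearMap.lTensor (H ⊗[k] H) (LinearMap.rTensor H (hitL f)) (comulTensor t) := by
  induction t with
  | zero => simp
  | add a b ha hb => simp only [map_add, ha, hb]
  | tmul g h =>
    have h1 := tensorTensorTensorComm_map (hitR f) LinearMap.id LinearMap.id LinearMap.id
      (comul (R := k) g ⊗ₜ[k] comul (R := k) h)
    have h2 := tensorTensorTensorComm_map LinearMap.id (hitL f) LinearMap.id LinearMap.id
      (comul (R := k) g ⊗ₜ[k] comul (R := k) h)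
    have h3 := rTensor_hitR_comul f g
    simp only [LinearMap.rTensor, LinearMap.lTensor, TensorProduct.map_id, LinearMap.id_apply,
      TensorProduct.map_tmul, comulTensor, LinearMap.comp_apply, LinearEquiv.coe_coe] at h1 h2 h3 ⊢
    rw [← h1, ← h2, h3]

lemma rTensor_lTensor_hitR_comulTensor (f : H →ₗ[k] k) (t : H ⊗[k] H) :
    LinearMap.rTensor (H ⊗[k] H) (LinearMap.lTensor H (hitR f)) (comulTensor t) =
      LinearMap.lTensor (H ⊗[k] H) (LinearMap.lTensor H (hitL f)) (comulTensor t) := by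
  induction t with
  | zero => simp
  | add a b ha hb => simp only [map_add, ha, hb]
  | tmul g h =>
    have h1 := tensorTensorTensorComm_map LinearMap.id LinearMap.id (hitR f) LinearMap.id
      (comul (R := k) g ⊗ₜ[k] comul (R := k) h)
    have h2 := tensorTensorTensorComm_map LinearMap.id LinearMap.id LinearMap.id (hitL f)
      (comul (R := k) g ⊗ₜ[k] comul (R := k) h)
    have h3 := rTensor_hitR_comul f h
    simp only [LinearMap.rTensor, LinearMap.lTensor, TensorProduct.map_id, LinearMap.id_apply,
      TensorProduct.map_tmul, comulTensor, LinearMap.comp_apply, LinearEquiv.coe_coe] at h1 h2 h3 ⊢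
    rw [← h1, ← h2, h3]

lemma sliceR_counit_comulTensor (f : H →ₗ[k] k) (t : H ⊗[k] H) :
    sliceR (LinearMap.mul' k k ∘ₗ TensorProduct.map (counit (R := k)) f) (comulTensor t) =
      LinearMap.lTensor H (hitR f) t := by
  have key (a b : H ⊗[k] H) :
      sliceR (LinearMap.mul' k k ∘ₗ TensorProduct.map (counit (R := k)) f)
        (tensorTensorTensorComm k H H H H (a ⊗ₜ[k] b)) =
      sliceR (counit (R := k)) a ⊗ₜ[k] sliceR f b := by
    induction a with
    | zero => simp
    | add a a' ha ha' => simp only [TensorProduct.add_tmul, map_add, ha, ha']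
    | tmul a a' =>
      induction b with
      | zero => simp
      | add b b' hb hb' => simp only [TensorProduct.tmul_add, map_add, hb, hb']
      | tmul b b' => simp [TensorProduct.smul_tmul', smul_smul, mul_comm]
  induction t with
  | zero => simp
  | add a b ha hb => simp only [map_add, ha, hb]
  | tmul g h =>
    simp only [comulTensor, LinearMap.comp_apply, TensorProduct.map_tmul, LinearEquiv.coe_coe, key]
    simp [hitR, sliceR]

namespace LeftBicoalgebroid

variable (B : LeftBicoalgebroid k H C)

lemma alpha_hitL_beta (φ ψ : C →ₗ[k] k) (h : H) :
    φ (B.α (hitL (ψ ∘ₗ B.β) h)) = ψ (B.β (hitL (φ ∘ₗ B.α) h)) := by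
  have key (y : H ⊗[k] H) : LinearMap.mul' k k (TensorProduct.map (ψ ∘ₗ B.β) (φ ∘ₗ B.α) y) =
      LinearMap.mul' k k (TensorProduct.map φ ψ
        (TensorProduct.map B.α B.β (TensorProduct.comm k H H y))) := by
    induction y <;> simp_all [mul_comm]
  have h1 := apply_hitL (φ ∘ₗ B.α) (ψ ∘ₗ B.β) h
  have h2 := apply_hitL (ψ ∘ₗ B.β) (φ ∘ₗ B.α) h
  rw [key, ← B.cocommute, ← LinearMap.comp_apply (TensorProduct.map φ ψ),
    ← TensorProduct.map_comp, ← h2] at h1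
  exact h1

lemma hitL_comm (φ ψ : C →ₗ[k] k) (h : H) :
    hitL (φ ∘ₗ B.α) (hitL (ψ ∘ₗ B.β) h) = hitL (ψ ∘ₗ B.β) (hitL (φ ∘ₗ B.α) h) := by
  rw [hitL_hitL, hitL_hitL]
  congr 2
  ext h
  exact B.alpha_hitL_beta φ ψ h

lemma mu_lTensor_hitR (φ : C →ₗ[k] k) {t : H ⊗[k] H} (ht : inCot B.α B.β t) :
    B.mu (LinearMap.lTensor H (hitR (φ ∘ₗ B.α)) t) =
      B.mu (LinearMap.rTensor H (hitR (φ ∘ₗ B.β)) t) := by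
  have h := congrArg (sliceR φ) (B.mu_takeuchi t ht)
  have hc : sliceR (φ ∘ₗ B.β) ∘ₗ (TensorProduct.comm k H H).toLinearMap = sliceL (φ ∘ₗ B.β) := by
    ext; simp
  rwa [sliceR_map, sliceR_map, sliceR_assoc_symm, sliceR_assoc_symm,
    ← LinearMap.comp_apply (LinearMap.lTensor _ _), ← LinearMap.comp_apply (LinearMap.lTensor _ _),
    ← LinearMap.lTensor_comp, ← LinearMap.lTensor_comp, hc, lTensor_sliceL_assoc,
    ← LinearMap.comp_apply (LinearMap.rTensor _ _), ← LinearMap.rTensor_comp] at h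

lemma hitL_mu (φ : C →ₗ[k] k) {t : H ⊗[k] H} (ht : inCot B.α B.β t) :
    hitL (φ ∘ₗ B.β) (B.mu t) = B.mu (LinearMap.lTensor H (hitL (φ ∘ₗ B.β)) t) := by
  have h := congrArg (sliceR φ) (B.mu_rightComod t ht)
  have hc : sliceR (φ ∘ₗ B.β) ∘ₗ (TensorProduct.comm k H H).toLinearMap = sliceL (φ ∘ₗ B.β) := by
    ext; simp
  rwa [← LinearMap.comp_apply (sliceR φ), sliceR_rhoL, sliceR_map, sliceR_assoc_symm,
    ← LinearMap.comp_apply (LinearMap.lTensor _ _), ← LinearMap.lTensor_comp,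
    ← LinearMap.comp_assoc, hc] at h

lemma inCot_lTensor_hitL (φ : C →ₗ[k] k) {t : H ⊗[k] H} (ht : inCot B.α B.β t) :
    inCot B.α B.β (LinearMap.lTensor H (hitL (φ ∘ₗ B.β)) t) := by
  rw [inCot_iff] at ht ⊢
  intro ψ
  rw [rTensor_comm_lTensor, ht, ← LinearMap.comp_apply, ← LinearMap.comp_apply,
    ← LinearMap.lTensor_comp, ← LinearMap.lTensor_comp]
  congr 2
  ext h
  exact (B.hitL_comm ψ φ h).symm

/-- `β(g h) = ε(g) β(h)`, tested on functionals. -/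
lemma beta_mu (φ : C →ₗ[k] k) {t : H ⊗[k] H} (ht : inCot B.α B.β t) :
    φ (B.β (B.mu t)) =
      LinearMap.mul' k k (TensorProduct.map (counit (R := k)) (φ ∘ₗ B.β) t) := by
  have h := counit_hitL (φ ∘ₗ B.β) (B.mu t)
  rw [B.hitL_mu φ ht, B.mu_counit _ (B.inCot_lTensor_hitL φ ht)] at h
  refine h.symm.trans ?_
  have key : (counit (R := k)) ∘ₗ hitL (φ ∘ₗ B.β) = φ ∘ₗ B.β := by
    ext h; exact counit_hitL _ _
  rw [LinearMap.lTensor, ← LinearMap.comp_apply (TensorProduct.map _ _), ← TensorProduct.map_comp,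
    key, LinearMap.comp_id]
  induction TensorProduct.map (counit (R := k)) (φ ∘ₗ B.β) t <;> simp_all

lemma inCot_sliceR_comulTensor (f : H ⊗[k] H →ₗ[k] k) {t : H ⊗[k] H} (ht : inCot B.α B.β t) :
    inCot B.α B.β (sliceR f (comulTensor t)) := by
  rw [inCot_iff] at ht ⊢
  intro ψ
  rw [← sliceR_rTensor, ← sliceR_rTensor, ← comulTensor_rTensor_hitL, ht, comulTensor_lTensor_hitL]

lemma inCot_sliceL_mu_comulTensor (χ : H →ₗ[k] k) {t : H ⊗[k] H} (ht : inCot B.α B.β t) :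
    inCot B.α B.β (sliceL χ (LinearMap.rTensor (H ⊗[k] H) B.mu (comulTensor t))) := by
  rw [inCot_iff]
  intro ψ
  rw [← sliceL_lTensor, ← sliceL_lTensor, ← rTensor_comm_lTensor, ← rTensor_comm_lTensor,
    ← rTensor_rTensor_hitR_comulTensor, ← rTensor_lTensor_hitR_comulTensor]
  congr 1
  refine ext_sliceR fun f => ?_
  simp only [sliceR_rTensor]
  exact (B.mu_lTensor_hitR ψ (B.inCot_sliceR_comulTensor f ht)).symm

/-- `(g h)_(1) ⊗ β((g h)_(2)) = g h_(1) ⊗ β(h_(2))`, tested on functionals. -/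
lemma hitR_mu (φ : C →ₗ[k] k) {t : H ⊗[k] H} (ht : inCot B.α B.β t) :
    hitR (φ ∘ₗ B.β) (B.mu t) = B.mu (LinearMap.lTensor H (hitR (φ ∘ₗ B.β)) t) := by
  rw [hitR, LinearMap.comp_apply, B.mu_comul t ht, ← hitR, ← sliceR_counit_comulTensor,
    ← sliceR_rTensor, sliceR_map, ← sliceR_rTensor]
  exact sliceR_eq_of_sliceL fun χ => B.beta_mu φ (B.inCot_sliceL_mu_comulTensor χ ht)

lemma hitL_alpha_eta (φ : C →ₗ[k] k) (c : C) :
    hitL (φ ∘ₗ B.α) (B.eta c) = B.eta (hitL φ c) := by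
  have h := congrArg (sliceL φ) (B.eta_leftComod c)
  rwa [← LinearMap.comp_apply (sliceL φ), sliceL_lamL, sliceL_lTensor] at h

lemma hitL_beta_eta (φ : C →ₗ[k] k) (c : C) :
    hitL (φ ∘ₗ B.β) (B.eta c) = B.eta (hitR φ c) := by
  have h := congrArg (sliceR φ) (B.eta_rightComod c)
  rwa [← LinearMap.comp_apply (sliceR φ), sliceR_rhoL, sliceR_rTensor] at h

lemma hitL_beta (φ : C →ₗ[k] k) (h : H) : hitL φ (B.β h) = B.β (hitR (φ ∘ₗ B.β) h) := by
  rw [hitL, LinearMap.comp_apply, B.beta_comul, sliceL_comm, sliceR_map]; rfl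

lemma rTensor_hitL_rhoL (φ : C →ₗ[k] k) (h : H) :
    LinearMap.rTensor C (hitL (φ ∘ₗ B.β)) (rhoL k H C B.β h) =
      LinearMap.lTensor H (hitL φ) (rhoL k H C B.β h) := by
  refine ext_sliceR fun ψ => ?_
  rw [sliceR_rTensor, sliceR_lTensor, ← LinearMap.comp_apply (sliceR ψ), sliceR_rhoL,
    ← LinearMap.comp_apply (sliceR _), sliceR_rhoL, hitL_hitL]
  change _ = sliceL ((ψ ∘ₗ hitL φ) ∘ₗ B.β) (comul h)
  congr 2
  ext g
  have h1 := apply_hitL (φ ∘ₗ B.β) (ψ ∘ₗ B.β) g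
  have h2 := apply_hitR (ψ ∘ₗ B.β) (φ ∘ₗ B.β) g
  simp only [LinearMap.comp_apply] at h1 h2 ⊢
  rw [h1, B.hitL_beta, h2]

lemma inCot_eta_rhoL (h : H) :
    inCot B.α B.β (LinearMap.lTensor H B.eta (rhoL k H C B.β h)) := by
  rw [inCot_iff]
  intro φ
  rw [rTensor_comm_lTensor, rTensor_hitL_rhoL, lTensor_lTensor, lTensor_lTensor]
  congr 2
  ext c
  exact (B.hitL_alpha_eta φ c).symm

lemma inCot_lTensor_hitR (f : H →ₗ[k] k) {t : H ⊗[k] H} (ht : inCot B.α B.β t) :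
    inCot B.α B.β (LinearMap.lTensor H (hitR f) t) := by
  rw [inCot_iff] at ht ⊢
  intro φ
  rw [rTensor_comm_lTensor, ht, lTensor_lTensor, lTensor_lTensor]
  congr 2
  ext h
  exact hitR_hitL _ _ h

lemma inCotXH_lTensor_hitL {rhoX : X →ₗ[k] X ⊗[k] C} (φ : C →ₗ[k] k) {w : X ⊗[k] H}
    (hw : inCotXH k H C B.α rhoX w) :
    inCotXH k H C B.α rhoX (LinearMap.lTensor X (hitL (φ ∘ₗ B.β)) w) := by
  rw [inCotXH_iff] at hw ⊢
  intro ψ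
  rw [rTensor_comm_lTensor, hw, lTensor_lTensor, lTensor_lTensor]
  congr 2
  ext h
  exact (B.hitL_comm ψ φ h).symm

lemma inCotXH_lTensor_hitR {rhoX : X →ₗ[k] X ⊗[k] C} (f : H →ₗ[k] k) {w : X ⊗[k] H}
    (hw : inCotXH k H C B.α rhoX w) :
    inCotXH k H C B.α rhoX (LinearMap.lTensor X (hitR f) w) := by
  rw [inCotXH_iff] at hw ⊢
  intro φ
  rw [rTensor_comm_lTensor, hw, lTensor_lTensor, lTensor_lTensor]
  congr 2
  ext h
  exact hitR_hitL _ _ h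

/-- `x ◁ h_(1) ⊗ β(h_(2))` with the factors exchanged, contracted with a functional. -/
lemma sliceL_act_comul (act : X ⊗[k] H →ₗ[k] X) (φ : C →ₗ[k] k) (w : X ⊗[k] H) :
    sliceL φ ((TensorProduct.comm k X C)
      ((TensorProduct.map act LinearMap.id)
        ((TensorProduct.assoc k X H C).symm
          ((LinearMap.lTensor X (LinearMap.lTensor H B.β ∘ₗ comul)) w)))) =
      act (LinearMap.lTensor X (hitR (φ ∘ₗ B.β)) w) := by
  rw [sliceL_comm, sliceR_map, sliceR_assoc_symm, lTensor_lTensor, LinearMap.comp_id]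
  congr 3
  ext h
  simp [sliceR_lTensor, hitR]

section RightModule

variable {rhoX : X →ₗ[k] X ⊗[k] C} {act : X ⊗[k] H →ₗ[k] X}

lemma inCotXH_eta_rho
    (hX1 : ∀ x : X, (TensorProduct.assoc k X C C)
        ((LinearMap.rTensor C rhoX) (rhoX x)) = (LinearMap.lTensor X (comul (R := k))) (rhoX x))
    (x : X) : inCotXH k H C B.α rhoX (LinearMap.lTensor X B.eta (rhoX x)) := by
  rw [inCotXH_iff]
  intro φ
  rw [rTensor_comm_lTensor, ← rTensor_rTensor, ← lTensor_sliceL_assoc, hX1, lTensor_lTensor,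
    lTensor_lTensor, lTensor_lTensor]
  congr 2
  ext c
  exact (B.hitL_alpha_eta φ c).symm

lemma eta_rho_sliceR
    (hX1 : ∀ x : X, (TensorProduct.assoc k X C C)
        ((LinearMap.rTensor C rhoX) (rhoX x)) = (LinearMap.lTensor X (comul (R := k))) (rhoX x))
    (φ : C →ₗ[k] k) (x : X) :
    LinearMap.lTensor X B.eta (rhoX (sliceR φ (rhoX x))) =
      LinearMap.lTensor X (hitL (φ ∘ₗ B.β)) (LinearMap.lTensor X B.eta (rhoX x)) := by
  rw [← sliceR_rTensor, (LinearEquiv.eq_symm_apply _).2 (hX1 x), sliceR_assoc_symm,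
    lTensor_lTensor, lTensor_lTensor, lTensor_lTensor]
  congr 2
  ext c
  exact (B.hitL_beta_eta φ c).symm

lemma rho_act
    (hact_com : ∀ w : X ⊗[k] H, inCotXH k H C B.α rhoX w →
      rhoX (act w) = (TensorProduct.map act B.β)
        ((TensorProduct.assoc k X H H).symm
          ((LinearMap.lTensor X
            ((TensorProduct.comm k H H).toLinearMap ∘ₗ comul (R := k))) w)))
    {w : X ⊗[k] H} (hw : inCotXH k H C B.α rhoX w) :
    rhoX (act w) = LinearMap.rTensor C act
      ((TensorProduct.assoc k X H C).symm (LinearMap.lTensor X (rhoL k H C B.β) w)) := by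
  refine ext_sliceR fun φ => ?_
  rw [hact_com w hw, sliceR_map, sliceR_rTensor, sliceR_assoc_symm, sliceR_assoc_symm,
    lTensor_lTensor, lTensor_lTensor, sliceR_rhoL]
  congr 3
  ext h
  simp [sliceR_comm, hitL]

lemma sliceR_rho_act
    (hact_com : ∀ w : X ⊗[k] H, inCotXH k H C B.α rhoX w →
      rhoX (act w) = (TensorProduct.map act B.β)
        ((TensorProduct.assoc k X H H).symm
          ((LinearMap.lTensor X
            ((TensorProduct.comm k H H).toLinearMap ∘ₗ comul (R := k))) w)))
    (φ : C →ₗ[k] k) {w : X ⊗[k] H} (hw : inCotXH k H C B.α rhoX w) :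
    sliceR φ (rhoX (act w)) = act (LinearMap.lTensor X (hitL (φ ∘ₗ B.β)) w) := by
  rw [B.rho_act hact_com hw, sliceR_rTensor, sliceR_assoc_symm, lTensor_lTensor, sliceR_rhoL]

/-- The canonical left coaction turns `◁` into a left comodule map, tested on functionals. -/
lemma act_hitR_eta_act
    (hact_com : ∀ w : X ⊗[k] H, inCotXH k H C B.α rhoX w →
      rhoX (act w) = (TensorProduct.map act B.β)
        ((TensorProduct.assoc k X H H).symm
          ((LinearMap.lTensor X
            ((TensorProduct.comm k H H).toLinearMap ∘ₗ comul (R := k))) w)))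
    (hact_assoc : ∀ u : (X ⊗[k] H) ⊗[k] H,
      (LinearMap.rTensor H (LinearMap.rTensor H rhoX)) u =
        (LinearMap.rTensor H
          ((TensorProduct.assoc k X C H).symm.toLinearMap ∘ₗ
            LinearMap.lTensor X (lamL k H C B.α))) u →
      (LinearMap.lTensor X (cotL B.β)) ((TensorProduct.assoc k X H H) u) =
        (LinearMap.lTensor X (cotR B.α)) ((TensorProduct.assoc k X H H) u) →
      act ((LinearMap.rTensor H act) u) =
        act ((LinearMap.lTensor X B.mu) ((TensorProduct.assoc k X H H) u)))
    (φ : C →ₗ[k] k) {w : X ⊗[k] H} (hw : inCotXH k H C B.α rhoX w) :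
    act (LinearMap.lTensor X (hitR (φ ∘ₗ B.β)) (LinearMap.lTensor X B.eta (rhoX (act w)))) =
      act (LinearMap.lTensor X (hitR (φ ∘ₗ B.β)) w) := by
  rw [B.rho_act hact_com hw, lTensor_lTensor, ← rTensor_comm_lTensor, lTensor_assoc_symm,
    lTensor_lTensor, hact_assoc, LinearEquiv.apply_symm_apply, lTensor_lTensor]
  · congr 3
    ext h
    rw [LinearMap.comp_apply, LinearMap.comp_apply, ← lTensor_lTensor,
      ← B.hitR_mu φ (B.inCot_eta_rhoL h), B.unit_right]
  · refine ext_sliceR fun χ => ?_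
    rw [sliceR_rTensor, sliceR_rTensor, sliceR_assoc_symm, lTensor_lTensor]
    have key : sliceR χ ∘ₗ (LinearMap.lTensor H (hitR (φ ∘ₗ B.β) ∘ₗ B.eta) ∘ₗ rhoL k H C B.β) =
        hitL ((χ ∘ₗ hitR (φ ∘ₗ B.β) ∘ₗ B.eta) ∘ₗ B.β) := by
      rw [← sliceR_rhoL]
      ext h
      exact sliceR_lTensor _ _ _
    rw [key]
    exact B.inCotXH_lTensor_hitL _ hw
  · rw [LinearEquiv.apply_symm_apply, lTensor_lTensor, lTensor_lTensor]
    congr 2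
    ext h
    have := B.inCot_lTensor_hitR (φ ∘ₗ B.β) (B.inCot_eta_rhoL h)
    rwa [lTensor_lTensor] at this

end RightModule

end LeftBicoalgebroid

end Bicoalgebroid

theorem right_module_unique_left_coaction
    (B : LeftBicoalgebroid k H C)
    (rhoX : X →ₗ[k] X ⊗[k] C)
    -- ρ_X is a coassociative counital right C-coaction
    (hX1 : ∀ x : X, (TensorProduct.assoc k X C C)
        ((LinearMap.rTensor C rhoX) (rhoX x)) = (LinearMap.lTensor X (comul (R := k))) (rhoX x))
    (hX2 : ∀ x : X, (TensorProduct.rid k X)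
        ((LinearMap.lTensor X (counit (R := k) (A := C))) (rhoX x)) = x)
    (act : X ⊗[k] H →ₗ[k] X)
    -- ◁ is a right C-comodule map: (x ◁ h)_[0] ⊗ (x ◁ h)_[1] = x ◁ h_(2) ⊗ β(h_(1))
    (hact_com : ∀ w : X ⊗[k] H, inCotXH k H C B.α rhoX w →
      rhoX (act w) = (TensorProduct.map act B.β)
        ((TensorProduct.assoc k X H H).symm
          ((LinearMap.lTensor X
            ((TensorProduct.comm k H H).toLinearMap ∘ₗ comul (R := k))) w)))
    -- ◁ is unital: x_[0] ◁ η(x_[1]) = x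
    (hact_unit : ∀ x : X, act ((LinearMap.lTensor X B.eta) (rhoX x)) = x)
    -- ◁ is associative on X ▢_C H ▢_C H
    (hact_assoc : ∀ u : (X ⊗[k] H) ⊗[k] H,
      (LinearMap.rTensor H (LinearMap.rTensor H rhoX)) u =
        (LinearMap.rTensor H
          ((TensorProduct.assoc k X C H).symm.toLinearMap ∘ₗ
            LinearMap.lTensor X (lamL k H C B.α))) u →
      (LinearMap.lTensor X (cotL B.β)) ((TensorProduct.assoc k X H H) u) =
        (LinearMap.lTensor X (cotR B.α)) ((TensorProduct.assoc k X H H) u) →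
      act ((LinearMap.rTensor H act) u) =
        act ((LinearMap.lTensor X B.mu) ((TensorProduct.assoc k X H H) u))) :
    -- the canonical formula τ(x) = β(η(x_[1])_(2)) ⊗ x_[0] ◁ η(x_[1])_(1)
    ∀ τ₀ : X →ₗ[k] C ⊗[k] X,
    τ₀ = (TensorProduct.comm k X C).toLinearMap ∘ₗ
        TensorProduct.map act LinearMap.id ∘ₗ
        (TensorProduct.assoc k X H C).symm.toLinearMap ∘ₗ
        LinearMap.lTensor X (LinearMap.lTensor H B.β ∘ₗ comul (R := k) ∘ₗ B.eta) ∘ₗ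
        rhoX →
    -- τ₀ has properties (1)-(3), and it is the unique such left coaction
    GoodLeftCoaction k H C B rhoX act τ₀ ∧
      (∀ τ : X →ₗ[k] C ⊗[k] X, GoodLeftCoaction k H C B rhoX act τ → τ = τ₀) := by
  intro τ₀ hτ₀
  have canonical (φ : C →ₗ[k] k) (x : X) : sliceL φ (τ₀ x) =
      act (LinearMap.lTensor X (hitR (φ ∘ₗ B.β)) (LinearMap.lTensor X B.eta (rhoX x))) := by
    rw [← B.sliceL_act_comul, lTensor_lTensor, hτ₀]
    rfl
  have mem := B.inCotXH_eta_rho hX1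
  have left_comod (φ : C →ₗ[k] k) {w : X ⊗[k] H} (hw : inCotXH k H C B.α rhoX w) :
      sliceL φ (τ₀ (act w)) = act (LinearMap.lTensor X (hitR (φ ∘ₗ B.β)) w) := by
    rw [canonical, B.act_hitR_eta_act hact_com hact_assoc φ hw]
  refine ⟨⟨fun x => ?_, fun x => ?_, fun x => ?_, fun w hw => ?_, fun w hw => ?_⟩,
    fun τ hτ => ?_⟩
  · refine ext_sliceL fun φ => ext_sliceL fun ψ => ?_
    rw [sliceL_assoc, rTensor_rTensor, sliceL_rTensor, sliceL_lTensor, canonical _ x, canonical φ x,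
      left_comod ψ (B.inCotXH_lTensor_hitR _ (mem x)), lTensor_lTensor (hitR _) (hitR _)]
    congr 3
    ext h
    rw [LinearMap.comp_apply, hitR_hitR, hitR, LinearMap.comp_apply]
    congr 2
    ext g
    exact congrArg ψ (B.hitL_beta φ g)
  · have hc : (counit (R := k)) ∘ₗ B.β = counit (R := k) := LinearMap.ext B.beta_counit
    have hid : hitR (counit (R := k) (A := H)) = LinearMap.id := by
      ext h
      simp [hitR, sliceR]
    have := canonical (counit (R := k)) x
    rwa [hc, hid, LinearMap.lTensor_id, LinearMap.id_apply, hact_unit] at this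
  · refine ext_sliceL fun φ => ext_sliceR fun ψ => ?_
    rw [sliceL_assoc, rTensor_rTensor, sliceR_rTensor, sliceL_lTensor, LinearMap.comp_apply,
      canonical, canonical, B.eta_rho_sliceR hX1,
      B.sliceR_rho_act hact_com ψ (B.inCotXH_lTensor_hitR _ (mem x)),
      lTensor_lTensor (hitL _) (hitR _), lTensor_lTensor (hitR _) (hitL _)]
    congr 3
    ext h
    exact hitR_hitL _ _ h
  · refine ext_sliceL fun φ => ?_
    rw [left_comod φ hw, B.sliceL_act_comul]
  · congr 2
    rw [rTensor_rTensor, hτ₀]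
    congr 2
    ext x
    simp [LinearMap.rTensor]
  · ext x
    refine ext_sliceL fun φ => ?_
    rw [canonical, ← B.sliceL_act_comul, ← hτ.2.2.2.1 _ (mem x), hact_unit]
end
end
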